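/- arXiv:2603.11100 — 11 statements merged into one kernel-verified Lean document; each statement's English description precedes it below -/
import Mathlib

section
/- Let m ≥ 2 and n, r be positive integers. Let A = {a₁,…,aₙ} and B = {b₁,…,bₙ} be multisets of row vectors in ℚ^r such that [A] =ⁿ_m [B]. Then the rank of the r×(2n) matrix [a₁ᵀ ⋯ aₙᵀ b₁ᵀ ⋯ bₙᵀ] equals the rank of the n×r matrix whose rows are a₁,…,aₙ, and also equals the rank of the n×r matrix whose rows are b₁,…,bₙ. -/
/-- `(a, b)` is a solution of the `r`-dimensional PTE problem of degree `m`
(index set `ι` for the size, coordinate set `κ` for the dimension):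
the two multisets of vectors are disjoint, and all mixed power sums of total
degree between `1` and `m` agree. -/
def IsPTE {ι κ : Type} [Fintype ι] [Fintype κ] (m : ℕ) (a b : ι → κ → ℚ) : Prop :=
  (∀ i j, a i ≠ b j) ∧
  ∀ k : κ → ℕ, 1 ≤ ∑ j, k j → ∑ j, k j ≤ m →
    ∑ i, ∏ j, a i j ^ k j = ∑ i, ∏ j, b i j ^ k j

/-- The Gram matrices of the two sides of a PTE solution of degree at least two agree. -/
theorem IsPTE.transpose_mul_self_eq {ι κ : Type} [Fintype ι] [Fintype κ] {m : ℕ} (hm : 2 ≤ m)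
    {a b : ι → κ → ℚ} (h : IsPTE m a b) :
    (Matrix.of a).transpose * Matrix.of a = (Matrix.of b).transpose * Matrix.of b := by
  classical
  ext i j
  have key := h.2 (Pi.single i 1 + Pi.single j 1)
    (by simp [Finset.sum_add_distrib]) (by simpa [Finset.sum_add_distrib] using hm)
  have prod_single (v : κ → ℚ) (l : κ) : ∏ x, v x ^ (Pi.single l 1 : κ → ℕ) x = v l := by
    simp [Pi.single_apply, pow_ite]
  simpa only [Matrix.mul_apply, Matrix.transpose_apply, Matrix.of_apply, Pi.add_apply, pow_add,
    Finset.prod_mul_distrib, prod_single] using key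

/-- Doubling a rational matrix preserves its rank. -/
theorem Matrix.rank_add_self {m n : Type*} [Fintype m] [Fintype n] (G : Matrix m n ℚ) :
    (G + G).rank = G.rank := by
  rw [← two_smul ℚ G]
  exact Matrix.rank_smul_of_mem_nonZeroDivisors G (mem_nonZeroDivisors_of_ne_zero two_ne_zero)

theorem stmt0 {m n r : ℕ} (hm : 2 ≤ m) (hn : 0 < n) (hr : 0 < r)
    (a b : Fin n → Fin r → ℚ) (h : IsPTE m a b) :
    (Matrix.of fun (i : Fin r) (j : Fin n ⊕ Fin n) =>
        Sum.elim (fun j' => a j' i) (fun j' => b j' i) j).rank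
      = (Matrix.of fun (i : Fin n) (j : Fin r) => a i j).rank ∧
    (Matrix.of fun (i : Fin r) (j : Fin n ⊕ Fin n) =>
        Sum.elim (fun j' => a j' i) (fun j' => b j' i) j).rank
      = (Matrix.of fun (i : Fin n) (j : Fin r) => b i j).rank := by
  set M := Matrix.of fun (i : Fin r) (j : Fin n ⊕ Fin n) =>
    Sum.elim (fun j' => a j' i) (fun j' => b j' i) j with hM
  change M.rank = (Matrix.of a).rank ∧ M.rank = (Matrix.of b).rank
  have hG := h.transpose_mul_self_eq hm
  have hMM : M * M.transpose =
      (Matrix.of a).transpose * Matrix.of a + (Matrix.of b).transpose * Matrix.of b := by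
    ext i j
    simp [hM, Matrix.mul_apply]
  rw [← Matrix.rank_self_mul_transpose M, hMM, ← Matrix.rank_transpose_mul_self (Matrix.of a),
    ← Matrix.rank_transpose_mul_self (Matrix.of b), hG, Matrix.rank_add_self]
  exact ⟨rfl, rfl⟩
end

section
/- (Combinatorial PTE inequality) Let t ≥ 1 and r ≥ 1, let Ω be a subset of ℚ^r, and let A = {a₁,…,aₙ} and B = {b₁,…,bₙ} be multisets of points of Ω such that (A,B) is a proper PTE_r solution of degree 2t and size n. Assume that the ℚ-linear evaluation map P_t(Ω) → ℚ^{2n}, f ↦ (f(a₁),…,f(aₙ),f(b₁),…,f(bₙ)), is injective. Then n ≥ dim_ℚ P_t(Ω). -/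
/-- `P_t(Ω)`: the space of functions `Ω → ℚ` which are restrictions to `Ω` of
polynomials in `r` variables of total degree at most `t`. -/
def Pt (r t : ℕ) (Ω : Set (Fin r → ℚ)) : Submodule ℚ (Ω → ℚ) where
  carrier := {f | ∃ p : MvPolynomial (Fin r) ℚ,
    p.totalDegree ≤ t ∧ ∀ x : Ω, f x = MvPolynomial.eval (x : Fin r → ℚ) p}
  add_mem' := by
    rintro f g ⟨p, hp, hf⟩ ⟨q, hq, hg⟩
    refine ⟨p + q, le_trans (MvPolynomial.totalDegree_add p q) (max_le hp hq), fun x => ?_⟩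
    simp [hf x, hg x]
  zero_mem' := ⟨0, by simp, fun x => by simp⟩
  smul_mem' := by
    rintro c f ⟨p, hp, hf⟩
    refine ⟨c • p, le_trans (MvPolynomial.totalDegree_smul_le c p) hp, fun x => ?_⟩
    simp [hf x]

/-- Polynomials of degree at most `m` have equal sums over the two sides of a PTE solution. -/
theorem IsPTE.sum_eval_eq {ι κ : Type} [Fintype ι] [Fintype κ] {m : ℕ} {a b : ι → κ → ℚ}
    (h : IsPTE m a b) {p : MvPolynomial κ ℚ} (hp : p.totalDegree ≤ m) :
    ∑ i, MvPolynomial.eval (a i) p = ∑ i, MvPolynomial.eval (b i) p := by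
  simp only [MvPolynomial.eval_eq']
  rw [Finset.sum_comm, Finset.sum_comm (s := Finset.univ)]
  refine Finset.sum_congr rfl fun d hd => ?_
  rw [← Finset.mul_sum, ← Finset.mul_sum]
  congr 1
  rcases Nat.eq_zero_or_pos (∑ j, d j) with h0 | h0
  · have hd0 : ∀ j, d j = 0 := by simpa using h0
    simp [hd0]
  · refine h.2 d h0 (le_trans ?_ hp)
    simpa [Finsupp.sum_fintype] using MvPolynomial.le_totalDegree hd

theorem stmt1 {t r n : ℕ} (ht : 1 ≤ t) (hr : 1 ≤ r)
    (Ω : Set (Fin r → ℚ)) (a b : Fin n → Fin r → ℚ)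
    (haΩ : ∀ i, a i ∈ Ω) (hbΩ : ∀ i, b i ∈ Ω)
    (hpte : IsPTE (2 * t) a b)
    (hrankA : (Matrix.of fun (i : Fin n) (j : Fin r) => a i j).rank = r)
    (hrankB : (Matrix.of fun (i : Fin n) (j : Fin r) => b i j).rank = r)
    (hinj : Function.Injective fun f : Pt r t Ω =>
      fun j : Fin n ⊕ Fin n =>
        Sum.elim (fun i => f.1 ⟨a i, haΩ i⟩) (fun i => f.1 ⟨b i, hbΩ i⟩) j) :
    Module.finrank ℚ (Pt r t Ω) ≤ n := by
  let L : Pt r t Ω →ₗ[ℚ] (Fin n → ℚ) :=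
    { toFun := fun f i => f.1 ⟨a i, haΩ i⟩
      map_add' := fun _ _ => rfl
      map_smul' := fun _ _ => rfl }
  have hL : Function.Injective L := by
    rw [injective_iff_map_eq_zero]
    intro f hf
    have ha : ∀ i, f.1 ⟨a i, haΩ i⟩ = 0 := fun i => congrFun hf i
    have hb : ∀ i, f.1 ⟨b i, hbΩ i⟩ = 0 := by
      obtain ⟨p, hp, hfp⟩ := f.2
      have hdeg : (p ^ 2).totalDegree ≤ 2 * t :=
        (MvPolynomial.totalDegree_pow p 2).trans (Nat.mul_le_mul_left 2 hp)
      have hsum : ∑ i, f.1 ⟨b i, hbΩ i⟩ ^ 2 = 0 := by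
        simpa [map_pow, ← hfp ⟨a _, haΩ _⟩, ← hfp ⟨b _, hbΩ _⟩, ha] using
          (hpte.sum_eval_eq hdeg).symm
      intro i
      exact pow_eq_zero_iff two_ne_zero |>.mp
        ((Finset.sum_eq_zero_iff_of_nonneg fun _ _ => sq_nonneg _).mp hsum i (Finset.mem_univ i))
    apply hinj
    funext j
    cases j with
    | inl i => exact ha i
    | inr i => exact hb i
  simpa using LinearMap.finrank_le_finrank_of_injective hL
end

section
/- Let t, k, r be positive integers with t ≤ k ≤ r − t. Let Ω = S_k^{r−1} be the binary sphere in ℚ^r, and let A = {a₁,…,aₙ} and B = {b₁,…,bₙ} be multisets of points of Ω such that (A,B) is a proper PTE_r solution of degree 2t and size n. Assume that the ℚ-linear evaluation map P_t(Ω) → ℚ^{2n}, f ↦ (f(a₁),…,f(aₙ),f(b₁),…,f(bₙ)), is injective. Then n ≥ C(r,t), the binomial coefficient r choose t. -/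
/-- The binary sphere `S_k^{r-1}`: all `(0,1)`-vectors in `ℚ^r` with exactly `k` ones. -/
def binarySphere (r k : ℕ) : Set (Fin r → ℚ) :=
  {x | (∀ j, x j = 0 ∨ x j = 1) ∧ ∑ j, x j = k}

theorem sum_powersetCard_succ_insert {α : Type*} [DecidableEq α] (c : Finset α → ℚ) (t : ℕ)
    {x : α} {K : Finset α} (hx : x ∉ K) :
    ∑ S ∈ (insert x K).powersetCard (t + 1), c S =
      ∑ S ∈ K.powersetCard (t + 1), c S + ∑ S ∈ K.powersetCard t, c (insert x S) := by
  have hmem {n : ℕ} {S : Finset α} (hS : S ∈ K.powersetCard n) : x ∉ S :=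
    fun h => hx ((Finset.mem_powersetCard.1 hS).1 h)
  rw [Finset.powersetCard_succ_insert hx, Finset.sum_union, Finset.sum_image]
  · intro S hS T hT h
    rw [← Finset.erase_insert (hmem hS), ← Finset.erase_insert (hmem hT), h]
  · rw [Finset.disjoint_left]
    intro S hS hS'
    obtain ⟨T, -, rfl⟩ := Finset.mem_image.1 hS'
    exact hmem hS (Finset.mem_insert_self x T)

/-- A function on `t`-subsets that is invariant under exchanging a single element is constant. -/
theorem eq_of_exchange_invariant {α β : Type*} [DecidableEq α] {X : Finset α} {t : ℕ}
    {c : Finset α → β}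
    (h : ∀ S ⊆ X, S.card = t → ∀ x ∈ X, ∀ y ∈ X, x ∉ S → y ∉ S →
      c (insert x S) = c (insert y S))
    {S T : Finset α} (hS : S ∈ X.powersetCard (t + 1)) (hT : T ∈ X.powersetCard (t + 1)) :
    c S = c T := by
  induction hm : (S \ T).card using Nat.strong_induction_on generalizing S with
  | _ m ih =>
    rw [Finset.mem_powersetCard] at hS hT
    have hcard : (S \ T).card = (T \ S).card :=
      Finset.card_sdiff_comm (hS.2.trans hT.2.symm)
    rcases Finset.eq_empty_or_nonempty (S \ T) with he | ⟨x, hx⟩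
    · rw [Finset.eq_of_subset_of_card_le (Finset.sdiff_eq_empty_iff_subset.1 he)
        (hT.2.trans hS.2.symm).le]
    · obtain ⟨y, hy⟩ : (T \ S).Nonempty :=
        Finset.card_pos.1 (hcard ▸ Finset.card_pos.2 ⟨x, hx⟩)
      rw [Finset.mem_sdiff] at hx hy
      have hyS : y ∉ S.erase x := fun h' => hy.2 (Finset.mem_of_mem_erase h')
      have hsub : S.erase x ⊆ X := (Finset.erase_subset x S).trans hS.1
      have hcard' : (S.erase x).card = t := by rw [Finset.card_erase_of_mem hx.1, hS.2]; rfl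
      have h1 := h _ hsub hcard' x (hS.1 hx.1) y (hT.1 hy.1) (Finset.notMem_erase x S) hyS
      rw [Finset.insert_erase hx.1] at h1
      rw [h1]
      refine ih _ ?_ (Finset.mem_powersetCard.2
        ⟨Finset.insert_subset (hT.1 hy.1) hsub, ?_⟩) rfl
      · rw [← hm]
        refine Finset.card_lt_card ⟨fun z hz => ?_, fun hss => ?_⟩
        · grind
        · have := hss (Finset.mem_sdiff.2 hx)
          grind
      · rw [Finset.card_insert_of_notMem hyS, hcard']

/-- The inclusion matrix of `t`-subsets versus `k`-subsets of `X` has trivial kernel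
(Gottlieb's theorem). -/
theorem eq_zero_of_sum_powersetCard_eq_zero {α : Type*} [DecidableEq α] {X : Finset α}
    {t k : ℕ} (htk : t ≤ k) (hX : t + k ≤ X.card) {c : Finset α → ℚ}
    (h : ∀ K ∈ X.powersetCard k, ∑ S ∈ K.powersetCard t, c S = 0) :
    ∀ S ∈ X.powersetCard t, c S = 0 := by
  induction t generalizing X k c with
  | zero =>
    intro S hS
    obtain ⟨K, hK⟩ := Finset.powersetCard_nonempty.2 (show k ≤ X.card by omega)
    have := h K hK
    simp only [Finset.powersetCard_zero, Finset.sum_singleton] at this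
    rwa [Finset.card_eq_zero.1 (Finset.mem_powersetCard.1 hS).2]
  | succ t ih =>
    obtain ⟨k, rfl⟩ : ∃ l, k = l + 1 := ⟨k - 1, by omega⟩
    have hexch : ∀ S ⊆ X, S.card = t → ∀ x ∈ X, ∀ y ∈ X, x ∉ S → y ∉ S →
        c (insert x S) = c (insert y S) := by
      intro S hSX hSt x hx y hy hxS hyS
      rcases eq_or_ne x y with rfl | hxy
      · rfl
      refine sub_eq_zero.1 (ih (X := (X.erase x).erase y) (k := k)
        (c := fun S => c (insert x S) - c (insert y S)) (by omega) ?_ ?_ S ?_)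
      · rw [Finset.card_erase_of_mem (Finset.mem_erase.2 ⟨hxy.symm, hy⟩),
          Finset.card_erase_of_mem hx]
        omega
      · intro K hK
        rw [Finset.mem_powersetCard] at hK
        have hxK : x ∉ K := fun h' => by simpa using hK.1 h'
        have hyK : y ∉ K := fun h' => by simpa using hK.1 h'
        have hKX : K ⊆ X := hK.1.trans ((Finset.erase_subset _ _).trans (Finset.erase_subset _ _))
        have hx' := h (insert x K) (Finset.mem_powersetCard.2
          ⟨Finset.insert_subset hx hKX, by rw [Finset.card_insert_of_notMem hxK, hK.2]⟩)
        have hy' := h (insert y K) (Finset.mem_powersetCard.2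
          ⟨Finset.insert_subset hy hKX, by rw [Finset.card_insert_of_notMem hyK, hK.2]⟩)
        rw [sum_powersetCard_succ_insert c t hxK] at hx'
        rw [sum_powersetCard_succ_insert c t hyK] at hy'
        rw [Finset.sum_sub_distrib]
        linarith
      · exact Finset.mem_powersetCard.2
          ⟨Finset.subset_erase.2 ⟨Finset.subset_erase.2 ⟨hSX, hxS⟩, hyS⟩, hSt⟩
    intro S hS
    obtain ⟨K, hK⟩ := Finset.powersetCard_nonempty.2 (show k + 1 ≤ X.card by omega)
    have hsum := h K hK
    rw [Finset.mem_powersetCard] at hK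
    rw [Finset.sum_congr rfl fun T hT => eq_of_exchange_invariant hexch
        (Finset.powersetCard_mono hK.1 hT) hS, Finset.sum_const, Finset.card_powersetCard, hK.2,
      nsmul_eq_mul, mul_eq_zero] at hsum
    exact hsum.resolve_left (by exact_mod_cast (Nat.choose_pos htk).ne')

/-- A polynomial of degree at most `t` vanishing on one side of a PTE solution of degree `2t`
vanishes on the other side. -/
theorem IsPTE.eval_eq_zero {ι κ : Type} [Fintype ι] [Fintype κ] {t : ℕ} {a b : ι → κ → ℚ}
    (h : IsPTE (2 * t) a b) {p : MvPolynomial κ ℚ} (hp : p.totalDegree ≤ t)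
    (ha : ∀ i, MvPolynomial.eval (a i) p = 0) (i : ι) : MvPolynomial.eval (b i) p = 0 := by
  have hsum := h.sum_eval_eq (p := p ^ 2)
    ((MvPolynomial.totalDegree_pow p 2).trans (Nat.mul_le_mul_left 2 hp))
  simp only [map_pow, ha, ne_eq, OfNat.ofNat_ne_zero, not_false_eq_true, zero_pow,
    Finset.sum_const_zero] at hsum
  exact pow_eq_zero_iff two_ne_zero |>.1
    ((Finset.sum_eq_zero_iff_of_nonneg fun i _ => sq_nonneg _).1 hsum.symm i (Finset.mem_univ i))

/-- The homogeneous multilinear polynomial of degree `t` with coefficients `c`. -/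
noncomputable def multilinear (r t : ℕ) :
    ((Finset.univ : Finset (Fin r)).powersetCard t → ℚ) →ₗ[ℚ] MvPolynomial (Fin r) ℚ :=
  Fintype.linearCombination ℚ fun S => ∏ j ∈ S.1, MvPolynomial.X j

theorem totalDegree_multilinear_le {r t : ℕ}
    (c : (Finset.univ : Finset (Fin r)).powersetCard t → ℚ) :
    (multilinear r t c).totalDegree ≤ t := by
  rw [multilinear, Fintype.linearCombination_apply]
  refine MvPolynomial.totalDegree_finsetSum_le fun S _ => ?_
  refine (MvPolynomial.totalDegree_smul_le _ _).trans
    ((MvPolynomial.totalDegree_finsetProd _ _).trans ?_)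
  simp [(Finset.mem_powersetCard.1 S.2).2]

theorem eq_zero_of_eval_multilinear_eq_zero {r t k : ℕ} (htk : t ≤ k) (hkr : t + k ≤ r)
    {c : (Finset.univ : Finset (Fin r)).powersetCard t → ℚ}
    (h : ∀ x ∈ binarySphere r k, MvPolynomial.eval x (multilinear r t c) = 0) : c = 0 := by
  let c' : Finset (Fin r) → ℚ := fun S =>
    if hS : S ∈ (Finset.univ : Finset (Fin r)).powersetCard t then c ⟨S, hS⟩ else 0
  have hc' (S : (Finset.univ : Finset (Fin r)).powersetCard t) : c' S = c S := dif_pos S.2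
  suffices ∀ S ∈ (Finset.univ : Finset (Fin r)).powersetCard t, c' S = 0 from
    funext fun S => (hc' S).symm.trans (this S S.2)
  refine eq_zero_of_sum_powersetCard_eq_zero htk (by simpa using hkr) fun K hK => ?_
  have hev := h (fun j => if j ∈ K then 1 else 0)
    ⟨fun j => (ite_eq_or_eq (j ∈ K) 1 0).symm, by simp [(Finset.mem_powersetCard.1 hK).2]⟩
  simp only [multilinear, Fintype.linearCombination_apply, map_sum, MvPolynomial.smul_eval,
    map_prod, MvPolynomial.eval_X, ← hc'] at hev
  rw [Finset.sum_coe_sort _ fun S => c' S * ∏ j ∈ S, if j ∈ K then (1 : ℚ) else 0] at hev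
  rw [← hev]
  refine Finset.sum_subset_zero_on_sdiff (Finset.powersetCard_mono (Finset.subset_univ K))
    (fun S hS => ?_) fun S hS => ?_
  · simp only [Finset.mem_sdiff, Finset.mem_powersetCard, Finset.subset_univ, true_and,
      not_and] at hS
    obtain ⟨j, hjS, hjK⟩ := Finset.not_subset.1 fun hSK => hS.2 hSK hS.1
    rw [Finset.prod_eq_zero hjS (if_neg hjK), mul_zero]
  · rw [Finset.prod_congr rfl fun j hj => if_pos ((Finset.mem_powersetCard.1 hS).1 hj),
      Finset.prod_const_one, mul_one]

theorem stmt2 {t k r n : ℕ} (ht : 1 ≤ t) (hk : 1 ≤ k) (hr : 1 ≤ r)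
    (htk : t ≤ k) (hkr : k ≤ r - t)
    (a b : Fin n → Fin r → ℚ)
    (haΩ : ∀ i, a i ∈ binarySphere r k) (hbΩ : ∀ i, b i ∈ binarySphere r k)
    (hpte : IsPTE (2 * t) a b)
    (hrankA : (Matrix.of fun (i : Fin n) (j : Fin r) => a i j).rank = r)
    (hrankB : (Matrix.of fun (i : Fin n) (j : Fin r) => b i j).rank = r)
    (hinj : Function.Injective fun f : Pt r t (binarySphere r k) =>
      fun j : Fin n ⊕ Fin n =>
        Sum.elim (fun i => f.1 ⟨a i, haΩ i⟩) (fun i => f.1 ⟨b i, hbΩ i⟩) j) :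
    r.choose t ≤ n := by
  let F : ((Finset.univ : Finset (Fin r)).powersetCard t → ℚ) →ₗ[ℚ] (Fin n → ℚ) :=
    LinearMap.pi (fun i => (MvPolynomial.aeval (a i)).toLinearMap) ∘ₗ multilinear r t
  have hF : Function.Injective F := by
    refine (injective_iff_map_eq_zero F).2 fun c hc => ?_
    have ha : ∀ i, MvPolynomial.eval (a i) (multilinear r t c) = 0 := fun i => by
      simpa [F, MvPolynomial.aeval_eq_eval] using congrFun hc i
    have hb := hpte.eval_eq_zero (totalDegree_multilinear_le c) ha
    let f : Pt r t (binarySphere r k) :=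
      ⟨fun x => MvPolynomial.eval x.1 (multilinear r t c),
        multilinear r t c, totalDegree_multilinear_le c, fun _ => rfl⟩
    have hf : f = 0 := hinj <| funext fun j => by
      rcases j with i | i
      · exact ha i
      · exact hb i
    refine eq_zero_of_eval_multilinear_eq_zero htk (by omega) fun x hx => ?_
    exact congrFun (congrArg Subtype.val hf) ⟨x, hx⟩
  simpa using LinearMap.finrank_le_finrank_of_injective hF
end

section
/- Let M be an n×r matrix over ℚ, and suppose there exist a, b ∈ ℚ such that MᵀM = a·I_r + b·J_r, where I_r is the r×r identity matrix and J_r is the r×r all-ones matrix. If a ≠ 0 and a + r·b ≠ 0, then rank M = r. -/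
open Matrix in
/-- Over a field, `a • I + b • J` is invertible as soon as its two eigenvalues `a` and `a + r * b`
are nonzero. -/
theorem isUnit_smul_one_add_smul_allOnes {K : Type*} [Field K] {r : ℕ} {a b : K}
    (ha : a ≠ 0) (hab : a + (r : K) * b ≠ 0) :
    IsUnit (a • (1 : Matrix (Fin r) (Fin r) K) + b • (Matrix.of fun _ _ => (1 : K))) := by
  rw [← mulVec_injective_iff_isUnit, ← coe_mulVecLin, ← LinearMap.ker_eq_bot,
    LinearMap.ker_eq_bot']
  intro v hv
  have coord : ∀ i, a * v i + b * ∑ j, v j = 0 := fun i => by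
    have hi := congrFun hv i
    rw [mulVecLin_apply, add_mulVec, smul_mulVec, smul_mulVec, one_mulVec] at hi
    simpa [mulVec, dotProduct] using hi
  have sum_eq_zero : ∑ j, v j = 0 := by
    have hs : ∑ i, (a * v i + b * ∑ j, v j) = 0 := Finset.sum_eq_zero fun i _ => coord i
    rw [Finset.sum_add_distrib, ← Finset.mul_sum, Finset.sum_const, Finset.card_univ,
      Fintype.card_fin, nsmul_eq_mul] at hs
    refine (mul_eq_zero.mp ?_).resolve_left hab
    linear_combination hs
  funext i
  simpa [sum_eq_zero, ha] using coord i

open Matrix in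
theorem stmt3 {n r : ℕ} (M : Matrix (Fin n) (Fin r) ℚ) (a b : ℚ)
    (h : Mᵀ * M = a • (1 : Matrix (Fin r) (Fin r) ℚ) +
                  b • (Matrix.of fun _ _ => (1 : ℚ)))
    (ha : a ≠ 0) (hab : a + (r : ℚ) * b ≠ 0) :
    M.rank = r := by
  rw [← rank_transpose_mul_self, h,
    rank_of_isUnit _ (isUnit_smul_one_add_smul_allOnes ha hab), Fintype.card_fin]
end

section
/- Let k ≥ 2 be an integer, and suppose (R,𝓑₁) and (R,𝓑₂) is a pair of 2-(4k−1, 2k−1, k−1) designs on the same point set with 𝓑₁ ∩ 𝓑₂ = ∅. Then the multisets X₁, X₂ of characteristic vectors of the blocks of 𝓑₁ and 𝓑₂ form a proper PTE_{4k−1} solution of degree 2 and size 4k−1, and this solution is tight for Ω = S_{2k−1}^{4k−2}: the size 4k−1 equals dim_ℚ P_1(Ω), and the evaluation map P_1(Ω) → ℚ^{2(4k−1)} at the points of X₁ and X₂ is injective. -/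
section Design

variable {ι α : Type} [Fintype ι] [DecidableEq α]

theorem sum_indicator_mul_indicator (B : ι → Finset α) (x y : α) :
    ∑ i, (if x ∈ B i then (1 : ℚ) else 0) * (if y ∈ B i then 1 else 0) =
      (Finset.univ.filter fun i => {x, y} ⊆ B i).card := by
  simp [← ite_and, Finset.insert_subset_iff, and_comm]

theorem indicator_ne_indicator {s t : Finset α} (h : s ≠ t) :
    (fun j => if j ∈ s then (1 : ℚ) else 0) ≠ fun j => if j ∈ t then (1 : ℚ) else 0 := by
  contrapose! h
  ext j
  have := congrFun h j
  by_cases hs : j ∈ s <;> by_cases ht : j ∈ t <;> simp_all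

variable [Fintype α]

/-- Double counting of the flags `(y, B)` with `y ≠ x` and `x, y ∈ B`. -/
theorem card_blocks_through_mul {κ l : ℕ} {B : ι → Finset α} (hcard : ∀ i, (B i).card = κ)
    (hpair : ∀ T : Finset α, T.card = 2 → (Finset.univ.filter fun i => T ⊆ B i).card = l) (x : α) :
    (Finset.univ.filter fun i => x ∈ B i).card * (κ - 1) = (Fintype.card α - 1) * l := by
  have h := Finset.sum_card_bipartiteAbove_eq_sum_card_bipartiteBelow
    (s := Finset.univ.filter fun i => x ∈ B i) (t := Finset.univ.erase x) fun i y => y ∈ B i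
  rw [Finset.sum_congr rfl (g := fun _ => κ - 1), Finset.sum_congr (s₁ := Finset.univ.erase x) rfl
    (g := fun _ => l)] at h
  · simpa [Finset.card_erase_of_mem] using h
  · intro y hy
    rw [← hpair {x, y} (Finset.card_pair (Finset.ne_of_mem_erase hy).symm)]
    congr 1
    ext i
    simp [Finset.bipartiteBelow, Finset.insert_subset_iff]
  · intro i hi
    rw [← hcard i, ← Finset.card_erase_of_mem (Finset.mem_filter.1 hi).2]
    congr 1
    ext y
    simp [Finset.bipartiteAbove]

theorem sum_card_blocks_through {κ : ℕ} {B : ι → Finset α} (hcard : ∀ i, (B i).card = κ) :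
    ∑ x, (Finset.univ.filter fun i => x ∈ B i).card = Fintype.card ι * κ := by
  have h := Finset.sum_card_bipartiteAbove_eq_sum_card_bipartiteBelow
    (s := (Finset.univ : Finset ι)) (t := (Finset.univ : Finset α)) fun i y => y ∈ B i
  simp [Finset.bipartiteAbove, Finset.bipartiteBelow, hcard] at h
  exact h.symm

/-- The Gram form of the incidence matrix of a design is `(r - l) I + l J`. -/
theorem sum_sq_incidence {r l : ℕ} {B : ι → Finset α}
    (hpoint : ∀ x, (Finset.univ.filter fun i => x ∈ B i).card = r)
    (hpair : ∀ T : Finset α, T.card = 2 → (Finset.univ.filter fun i => T ⊆ B i).card = l)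
    (c : α → ℚ) :
    ∑ i, (∑ x, (if x ∈ B i then (1 : ℚ) else 0) * c x) ^ 2 =
      (r - l) * ∑ x, c x ^ 2 + l * (∑ x, c x) ^ 2 := by
  have hgram (x y : α) :
      ∑ i, (if x ∈ B i then (1 : ℚ) else 0) * (if y ∈ B i then 1 else 0) =
        (r - l) * (if x = y then 1 else 0) + l := by
    rw [sum_indicator_mul_indicator]
    split_ifs with hxy
    · subst hxy
      simp [hpoint]
    · simp [hpair _ (Finset.card_pair hxy)]
  calc ∑ i, (∑ x, (if x ∈ B i then (1 : ℚ) else 0) * c x) ^ 2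
      = ∑ i, ∑ x, ∑ y, c x * c y *
          ((if x ∈ B i then (1 : ℚ) else 0) * (if y ∈ B i then 1 else 0)) := by
        refine Finset.sum_congr rfl fun i _ => ?_
        rw [sq, Finset.sum_mul_sum]
        exact Finset.sum_congr rfl fun x _ => Finset.sum_congr rfl fun y _ => by ring
    _ = ∑ x, ∑ y, c x * c y * ((r - l) * (if x = y then 1 else 0) + l) := by
        rw [Finset.sum_comm]
        refine Finset.sum_congr rfl fun x _ => ?_
        rw [Finset.sum_comm]
        refine Finset.sum_congr rfl fun y _ => ?_
        rw [← hgram, Finset.mul_sum]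
    _ = (r - l) * ∑ x, c x ^ 2 + l * (∑ x, c x) ^ 2 := by
        simp only [mul_add, Finset.sum_add_distrib]
        congr 1
        · rw [Finset.mul_sum]
          refine Finset.sum_congr rfl fun x _ => ?_
          simp
          ring
        · rw [sq, Finset.sum_mul_sum, Finset.mul_sum]
          refine Finset.sum_congr rfl fun x _ => ?_
          rw [Finset.mul_sum]
          exact Finset.sum_congr rfl fun y _ => by ring

theorem eq_zero_of_incidence_eq_zero {r l : ℕ} (hlr : l < r) {B : ι → Finset α}
    (hpoint : ∀ x, (Finset.univ.filter fun i => x ∈ B i).card = r)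
    (hpair : ∀ T : Finset α, T.card = 2 → (Finset.univ.filter fun i => T ⊆ B i).card = l)
    {c : α → ℚ} (hc : ∀ i, ∑ x, (if x ∈ B i then (1 : ℚ) else 0) * c x = 0) : c = 0 := by
  have h := sum_sq_incidence hpoint hpair c
  simp only [hc] at h
  have hlr' : (0 : ℚ) < r - l := sub_pos.2 (by exact_mod_cast hlr)
  have hsum : ∑ x, c x ^ 2 = 0 := by
    have h₁ : 0 ≤ ∑ x, c x ^ 2 := Finset.sum_nonneg fun x _ => sq_nonneg _
    have h₂ : 0 ≤ (l : ℚ) * (∑ x, c x) ^ 2 := by positivity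
    have h₃ : 0 ≤ (r - l : ℚ) * ∑ x, c x ^ 2 := mul_nonneg hlr'.le h₁
    have h₄ : (r - l : ℚ) * ∑ x, c x ^ 2 = 0 := by
      simp at h
      linarith
    exact (mul_eq_zero.1 h₄).resolve_left hlr'.ne'
  ext x
  simpa using (Finset.sum_eq_zero_iff_of_nonneg fun x _ => sq_nonneg (c x)).1 hsum x

theorem rank_incidence {r l : ℕ} (hlr : l < r) {B : ι → Finset α}
    (hpoint : ∀ x, (Finset.univ.filter fun i => x ∈ B i).card = r)
    (hpair : ∀ T : Finset α, T.card = 2 → (Finset.univ.filter fun i => T ⊆ B i).card = l) :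
    (Matrix.of fun (i : ι) (x : α) => if x ∈ B i then (1 : ℚ) else 0).rank = Fintype.card α := by
  rw [Matrix.rank, LinearMap.finrank_range_of_inj, Module.finrank_fintype_fun_eq_card]
  rw [← LinearMap.ker_eq_bot, LinearMap.ker_eq_bot']
  intro c hc
  exact eq_zero_of_incidence_eq_zero hlr hpoint hpair fun i => congrFun hc i

theorem prod_indicator_pow (s : Finset α) (e : α → ℕ) :
    ∏ j, (if j ∈ s then (1 : ℚ) else 0) ^ e j =
      if (Finset.univ.filter fun j => e j ≠ 0) ⊆ s then 1 else 0 := by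
  split_ifs with h
  · refine Finset.prod_eq_one fun j _ => ?_
    by_cases hj : e j = 0
    · simp [hj]
    · simp [h (Finset.mem_filter.2 ⟨Finset.mem_univ j, hj⟩)]
  · obtain ⟨j, hj, hjs⟩ := Finset.not_subset.1 h
    exact Finset.prod_eq_zero (Finset.mem_univ j) (by simpa [hjs] using hj)

/-- Two families of sets covering every set of at most `m` points equally often
form a solution of degree `m`. -/
theorem isPTE_of_card_eq {m : ℕ} {B C : ι → Finset α} (hdisj : ∀ i j, B i ≠ C j)
    (h : ∀ T : Finset α, T.Nonempty → T.card ≤ m →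
      (Finset.univ.filter fun i => T ⊆ B i).card = (Finset.univ.filter fun i => T ⊆ C i).card) :
    IsPTE m (fun i j => if j ∈ B i then (1 : ℚ) else 0)
      (fun i j => if j ∈ C i then (1 : ℚ) else 0) := by
  refine ⟨fun i j => indicator_ne_indicator (hdisj i j), fun e he hem => ?_⟩
  simp only [prod_indicator_pow, Finset.sum_boole]
  rw [h]
  · obtain ⟨j, hj, hj'⟩ := Finset.exists_ne_zero_of_sum_ne_zero (Nat.one_le_iff_ne_zero.1 he)
    exact ⟨j, by simpa using hj'⟩
  · refine le_trans ?_ hem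
    rw [Finset.card_filter]
    refine Finset.sum_le_sum fun j _ => ?_
    split_ifs with hj
    · exact Nat.one_le_iff_ne_zero.2 hj
    · exact Nat.zero_le _

theorem isPTE_two_of_design {r l : ℕ} {B C : ι → Finset α}
    (hpoint : ∀ x, (Finset.univ.filter fun i => x ∈ B i).card = r)
    (hpair : ∀ T : Finset α, T.card = 2 → (Finset.univ.filter fun i => T ⊆ B i).card = l)
    (hpoint' : ∀ x, (Finset.univ.filter fun i => x ∈ C i).card = r)
    (hpair' : ∀ T : Finset α, T.card = 2 → (Finset.univ.filter fun i => T ⊆ C i).card = l)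
    (hdisj : ∀ i j, B i ≠ C j) :
    IsPTE 2 (fun i j => if j ∈ B i then (1 : ℚ) else 0)
      (fun i j => if j ∈ C i then (1 : ℚ) else 0) := by
  refine isPTE_of_card_eq hdisj fun T hT hT2 => ?_
  have hpos := hT.card_pos
  obtain hT | hT : T.card = 1 ∨ T.card = 2 := by omega
  · obtain ⟨x, rfl⟩ := Finset.card_eq_one.1 hT
    simp [hpoint, hpoint']
  · rw [hpair T hT, hpair' T hT]

end Design

/-- Linear forms, restricted to `Ω`. -/
def linearForms (r : ℕ) (Ω : Set (Fin r → ℚ)) : (Fin r → ℚ) →ₗ[ℚ] (Ω → ℚ) where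
  toFun c x := ∑ j, (x : Fin r → ℚ) j * c j
  map_add' c d := by
    ext x
    simp [mul_add, Finset.sum_add_distrib]
  map_smul' a c := by
    ext x
    simp only [Pi.smul_apply, smul_eq_mul, RingHom.id_apply, Finset.mul_sum]
    exact Finset.sum_congr rfl fun j _ => by ring

@[simp]
theorem linearForms_apply (r : ℕ) (Ω : Set (Fin r → ℚ)) (c : Fin r → ℚ) (x : Ω) :
    linearForms r Ω c x = ∑ j, (x : Fin r → ℚ) j * c j := rfl

theorem monomial_mem_range_linearForms {r κ : ℕ} (hκ : κ ≠ 0) {m : Fin r →₀ ℕ}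
    (hm : m.degree ≤ 1) (a : ℚ) :
    (fun x : binarySphere r κ => MvPolynomial.eval (x : Fin r → ℚ) (MvPolynomial.monomial m a)) ∈
      LinearMap.range (linearForms r (binarySphere r κ)) := by
  obtain hm | hm : m.degree = 0 ∨ m.degree = 1 := by omega
  · obtain rfl := (Finsupp.degree_eq_zero_iff m).1 hm
    refine ⟨fun _ => a / κ, ?_⟩
    ext x
    have hκ' : (κ : ℚ) ≠ 0 := by exact_mod_cast hκ
    simp [← Finset.sum_mul, x.2.2, mul_div_cancel₀, hκ']
  · obtain ⟨j, rfl⟩ : m ∈ Set.range (Finsupp.single · 1) :=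
      Finsupp.range_single_one.symm ▸ hm
    refine ⟨Pi.single j a, ?_⟩
    ext x
    simp [Pi.single_apply, MvPolynomial.eval_monomial, mul_comm]

/-- On a binary sphere the constants are themselves linear forms. -/
theorem Pt_one_binarySphere {r κ : ℕ} (hκ : κ ≠ 0) :
    Pt r 1 (binarySphere r κ) = LinearMap.range (linearForms r (binarySphere r κ)) := by
  apply le_antisymm
  · rintro f ⟨p, hp, hf⟩
    have hsum : f = ∑ m ∈ p.support, fun x : binarySphere r κ =>
        MvPolynomial.eval (x : Fin r → ℚ) (MvPolynomial.monomial m (p.coeff m)) := by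
      ext x
      rw [hf, Finset.sum_apply, ← map_sum, ← p.as_sum]
    rw [hsum]
    exact Submodule.sum_mem _ fun m hm => monomial_mem_range_linearForms hκ
      ((MvPolynomial.le_totalDegree hm).trans hp) _
  · rintro _ ⟨c, rfl⟩
    refine ⟨∑ j, MvPolynomial.C (c j) * MvPolynomial.X j, ?_, fun x => ?_⟩
    · refine (MvPolynomial.totalDegree_finsetSum _ _).trans (Finset.sup_le fun j _ => ?_)
      refine (MvPolynomial.totalDegree_mul _ _).trans ?_
      simp
    · simp [mul_comm]

theorem indicator_mem_binarySphere {r κ : ℕ} {s : Finset (Fin r)} (hs : s.card = κ) :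
    (fun j => if j ∈ s then (1 : ℚ) else 0) ∈ binarySphere r κ :=
  ⟨fun j => by by_cases h : j ∈ s <;> simp [h], by simp [hs]⟩

theorem card_blocks_through {k : ℕ} (hk : 2 ≤ k) {ι : Type} [Fintype ι]
    {B : ι → Finset (Fin (4 * k - 1))} (hcard : ∀ i, (B i).card = 2 * k - 1)
    (hpair : ∀ T : Finset (Fin (4 * k - 1)), T.card = 2 →
      (Finset.univ.filter fun i => T ⊆ B i).card = k - 1) (x : Fin (4 * k - 1)) :
    (Finset.univ.filter fun i => x ∈ B i).card = 2 * k - 1 := by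
  have h := card_blocks_through_mul hcard hpair x
  obtain ⟨n, rfl⟩ : ∃ n, k = n + 1 := ⟨k - 1, by omega⟩
  rw [Fintype.card_fin, show 2 * (n + 1) - 1 - 1 = 2 * n by omega,
    show 4 * (n + 1) - 1 - 1 = 2 * (2 * n + 1) by omega, Nat.add_sub_cancel] at h
  have hn : 0 < 2 * n := by omega
  have := Nat.eq_of_mul_eq_mul_right hn (h.trans (show _ = (2 * n + 1) * (2 * n) by ring))
  omega


theorem stmt9 (k b : ℕ) (hk : 2 ≤ k)
    (𝓑₁ 𝓑₂ : Fin b → Finset (Fin (4 * k - 1)))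
    (hcard₁ : ∀ i, (𝓑₁ i).card = 2 * k - 1)
    (hcard₂ : ∀ i, (𝓑₂ i).card = 2 * k - 1)
    (hdes₁ : ∀ T : Finset (Fin (4 * k - 1)), T.card = 2 →
      (Finset.univ.filter fun i => T ⊆ 𝓑₁ i).card = k - 1)
    (hdes₂ : ∀ T : Finset (Fin (4 * k - 1)), T.card = 2 →
      (Finset.univ.filter fun i => T ⊆ 𝓑₂ i).card = k - 1)
    (hdisj : ∀ i j, 𝓑₁ i ≠ 𝓑₂ j) :
    b = 4 * k - 1 ∧
    IsPTE 2 (fun i j => if j ∈ 𝓑₁ i then (1 : ℚ) else 0)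
            (fun i j => if j ∈ 𝓑₂ i then (1 : ℚ) else 0) ∧
    (Matrix.of fun (i : Fin b) (j : Fin (4 * k - 1)) =>
        if j ∈ 𝓑₁ i then (1 : ℚ) else 0).rank = 4 * k - 1 ∧
    (Matrix.of fun (i : Fin b) (j : Fin (4 * k - 1)) =>
        if j ∈ 𝓑₂ i then (1 : ℚ) else 0).rank = 4 * k - 1 ∧
    Module.finrank ℚ (Pt (4 * k - 1) 1 (binarySphere (4 * k - 1) (2 * k - 1)))
      = 4 * k - 1 ∧
    ∃ (h₁ : ∀ i, (fun j => if j ∈ 𝓑₁ i then (1 : ℚ) else 0)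
              ∈ binarySphere (4 * k - 1) (2 * k - 1))
      (h₂ : ∀ i, (fun j => if j ∈ 𝓑₂ i then (1 : ℚ) else 0)
              ∈ binarySphere (4 * k - 1) (2 * k - 1)),
      Function.Injective fun f : Pt (4 * k - 1) 1 (binarySphere (4 * k - 1) (2 * k - 1)) =>
        fun j : Fin b ⊕ Fin b =>
          Sum.elim
            (fun i => f.1 ⟨fun j' => if j' ∈ 𝓑₁ i then (1 : ℚ) else 0, h₁ i⟩)
            (fun i => f.1 ⟨fun j' => if j' ∈ 𝓑₂ i then (1 : ℚ) else 0, h₂ i⟩) j := by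
  have hp₁ := card_blocks_through hk hcard₁ hdes₁
  have hp₂ := card_blocks_through hk hcard₂ hdes₂
  have hlr : k - 1 < 2 * k - 1 := by omega
  have hκ : 2 * k - 1 ≠ 0 := by omega
  have h₁ i := indicator_mem_binarySphere (hcard₁ i)
  have h₂ i := indicator_mem_binarySphere (hcard₂ i)
  refine ⟨?_, isPTE_two_of_design hp₁ hdes₁ hp₂ hdes₂ hdisj,
    (rank_incidence hlr hp₁ hdes₁).trans (Fintype.card_fin _),
    (rank_incidence hlr hp₂ hdes₂).trans (Fintype.card_fin _), ?_, h₁, h₂, ?_⟩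
  · have h := sum_card_blocks_through hcard₁
    simp only [hp₁, Finset.sum_const, Finset.card_univ, Fintype.card_fin, smul_eq_mul] at h
    exact (Nat.eq_of_mul_eq_mul_right (by omega) h).symm
  · rw [Pt_one_binarySphere hκ, LinearMap.finrank_range_of_inj, Module.finrank_fin_fun]
    rw [← LinearMap.ker_eq_bot, LinearMap.ker_eq_bot']
    intro c hc
    exact eq_zero_of_incidence_eq_zero hlr hp₁ hdes₁ fun i => congrFun hc ⟨_, h₁ i⟩
  · rintro ⟨f, hf⟩ ⟨g, hg⟩ hfg
    rw [Pt_one_binarySphere hκ] at hf hg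
    obtain ⟨c, rfl⟩ := hf
    obtain ⟨d, rfl⟩ := hg
    have hcd : c - d = 0 := by
      refine eq_zero_of_incidence_eq_zero hlr hp₁ hdes₁ fun i => ?_
      have hi : linearForms _ _ c ⟨_, h₁ i⟩ = linearForms _ _ d ⟨_, h₁ i⟩ :=
        congrFun hfg (Sum.inl i)
      rw [linearForms_apply, linearForms_apply] at hi
      simp only [Pi.sub_apply, mul_sub, Finset.sum_sub_distrib]
      exact sub_eq_zero.2 hi
    rw [Subtype.mk.injEq, sub_eq_zero.1 hcd]
end

section
/- Let p ≥ 7 be a prime with p ≡ 3 (mod 4), and let Q ⊆ F_p be the set of nonzero quadratic residues modulo p. Then the two block families 𝓑₁ = {Q + a : a ∈ F_p} and 𝓑₂ = {−Q + a : a ∈ F_p} form a disjoint pair of 2-(p, (p−1)/2, (p−3)/4) designs on the point set F_p; in particular, Q + a ≠ −Q + b for all a, b ∈ F_p. -/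
section NonzeroSquares

/-- The set of nonzero squares of a finite field. -/
def nonzeroSquares (F : Type*) [Field F] [Fintype F] [DecidableEq F] : Finset F :=
  Finset.univ.filter fun a : F => ∃ x : F, x ≠ 0 ∧ x * x = a

variable {F : Type*} [Field F] [Fintype F] [DecidableEq F]

theorem mem_nonzeroSquares {a : F} : a ∈ nonzeroSquares F ↔ ∃ x : F, x ≠ 0 ∧ x * x = a := by
  simp [nonzeroSquares]

theorem mem_nonzeroSquares_iff_isSquare {a : F} : a ∈ nonzeroSquares F ↔ a ≠ 0 ∧ IsSquare a := by
  rw [mem_nonzeroSquares]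
  constructor
  · rintro ⟨x, hx, rfl⟩
    exact ⟨mul_ne_zero hx hx, x, rfl⟩
  · rintro ⟨ha, x, rfl⟩
    exact ⟨x, left_ne_zero_of_mul ha, rfl⟩

theorem zero_notMem_nonzeroSquares : (0 : F) ∉ nonzeroSquares F := by
  simp [mem_nonzeroSquares_iff_isSquare]

theorem mul_mem_nonzeroSquares_iff {s a : F} (hs : s ∈ nonzeroSquares F) :
    s * a ∈ nonzeroSquares F ↔ a ∈ nonzeroSquares F := by
  simp only [mem_nonzeroSquares] at *
  obtain ⟨x, hx, rfl⟩ := hs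
  constructor
  · rintro ⟨y, hy, h⟩
    refine ⟨y / x, div_ne_zero hy hx, ?_⟩
    field_simp
    linear_combination h
  · rintro ⟨y, hy, rfl⟩
    exact ⟨x * y, mul_ne_zero hx hy, by ring⟩

theorem neg_mem_nonzeroSquares_iff (hF : Fintype.card F % 4 = 3) {a : F} (ha : a ≠ 0) :
    -a ∈ nonzeroSquares F ↔ a ∉ nonzeroSquares F := by
  have hchar : ringChar F ≠ 2 := fun h => by
    have := FiniteField.even_card_of_char_two h
    omega
  have hneg : ¬ IsSquare (-1 : F) := by
    rw [FiniteField.isSquare_neg_one_iff]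
    exact not_not.mpr hF
  rw [← quadraticChar_neg_one_iff_not_isSquare] at hneg
  simp only [mem_nonzeroSquares_iff_isSquare, ne_eq, neg_eq_zero, ha, not_false_eq_true, true_and]
  rw [← quadraticChar_neg_one_iff_not_isSquare,
    ← quadraticChar_one_iff_isSquare (neg_ne_zero.mpr ha), neg_eq_neg_one_mul, map_mul, hneg]
  omega

theorem two_mul_card_nonzeroSquares_add_one (hF : Fintype.card F % 4 = 3) :
    2 * (nonzeroSquares F).card + 1 = Fintype.card F := by
  have hneg : ((Finset.univ.erase (0 : F)).filter (· ∉ nonzeroSquares F)).card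
      = (nonzeroSquares F).card := by
    rw [← Finset.card_image_of_injective (nonzeroSquares F) neg_injective]
    congr 1
    ext a
    simp only [Finset.mem_filter, Finset.mem_erase, Finset.mem_univ, and_true, Finset.mem_image]
    constructor
    · rintro ⟨ha, h⟩
      exact ⟨-a, (neg_mem_nonzeroSquares_iff hF ha).mpr h, neg_neg a⟩
    · rintro ⟨b, hb, rfl⟩
      have hb0 : b ≠ 0 := fun h => zero_notMem_nonzeroSquares (h ▸ hb)
      exact ⟨neg_ne_zero.mpr hb0, fun h => (neg_mem_nonzeroSquares_iff hF hb0).mp h hb⟩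
  have hpos : (Finset.univ.erase (0 : F)).filter (· ∈ nonzeroSquares F) = nonzeroSquares F := by
    ext a
    simp only [Finset.mem_filter, Finset.mem_erase, Finset.mem_univ, and_true,
      and_iff_right_iff_imp]
    exact fun ha h => zero_notMem_nonzeroSquares (h ▸ ha)
  have hsum := Finset.card_filter_add_card_filter_not (s := Finset.univ.erase (0 : F))
    (· ∈ nonzeroSquares F)
  rw [hneg, hpos, Finset.card_erase_of_mem (Finset.mem_univ _), Finset.card_univ] at hsum
  have := Fintype.card_pos (α := F)
  omega

/-- The number of ways to write `d` as a difference of two nonzero squares. -/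
def squareDifferenceCount (d : F) : ℕ :=
  ((nonzeroSquares F).filter (· + d ∈ nonzeroSquares F)).card

theorem squareDifferenceCount_mul {s : F} (hs : s ∈ nonzeroSquares F) (d : F) :
    squareDifferenceCount (s * d) = squareDifferenceCount d := by
  have hs0 : s ≠ 0 := fun h => zero_notMem_nonzeroSquares (h ▸ hs)
  symm
  refine Finset.card_bij (fun a _ => s * a) ?_ (fun a _ b _ h => mul_left_cancel₀ hs0 h) ?_
  · intro a ha
    simpa only [Finset.mem_filter, ← mul_add, mul_mem_nonzeroSquares_iff hs] using ha
  · intro b hb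
    have hb' : s * (s⁻¹ * b) = b := mul_inv_cancel_left₀ hs0 b
    refine ⟨s⁻¹ * b, ?_, hb'⟩
    rw [← hb'] at hb
    simpa only [Finset.mem_filter, ← mul_add, mul_mem_nonzeroSquares_iff hs] using hb

theorem squareDifferenceCount_neg (d : F) :
    squareDifferenceCount (-d) = squareDifferenceCount d := by
  refine Finset.card_bij (fun a _ => a + -d) ?_ (fun a _ b _ h => add_right_cancel h) ?_
  · intro a ha
    simpa [and_comm] using ha
  · intro b hb
    exact ⟨b + d, by simpa [and_comm] using hb, by simp⟩

theorem squareDifferenceCount_eq_one (hF : Fintype.card F % 4 = 3) {d : F} (hd : d ≠ 0) :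
    squareDifferenceCount d = squareDifferenceCount (1 : F) := by
  by_cases h : d ∈ nonzeroSquares F
  · simpa using squareDifferenceCount_mul h 1
  · rw [← squareDifferenceCount_neg]
    simpa using squareDifferenceCount_mul ((neg_mem_nonzeroSquares_iff hF hd).mpr h) 1

theorem sum_squareDifferenceCount :
    ∑ d ∈ Finset.univ.erase (0 : F), squareDifferenceCount d
      = (nonzeroSquares F).card * (nonzeroSquares F).card - (nonzeroSquares F).card := by
  rw [← Finset.offDiag_card, Finset.card_eq_sum_card_fiberwise
    (f := fun x : F × F => x.2 - x.1) (t := Finset.univ.erase (0 : F))]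
  · refine Finset.sum_congr rfl fun d hd => ?_
    refine Finset.card_bij (fun a _ => (a, a + d)) ?_ (fun a _ b _ h => (Prod.ext_iff.mp h).1) ?_
    · intro a ha
      have hd0 : d ≠ 0 := Finset.ne_of_mem_erase hd
      simpa [hd0] using ha
    · rintro ⟨a, b⟩ h
      simp only [Finset.mem_filter, Finset.mem_offDiag] at h
      obtain ⟨⟨ha, hb, -⟩, rfl⟩ := h
      exact ⟨a, by simp [ha, hb], by simp⟩
  · rintro ⟨a, b⟩ h
    simp only [Finset.coe_offDiag, Set.mem_offDiag] at h
    simpa [sub_eq_zero] using Ne.symm h.2.2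

theorem squareDifferenceCount_eq (hF : Fintype.card F % 4 = 3) {d : F} (hd : d ≠ 0) :
    squareDifferenceCount d = (Fintype.card F - 3) / 4 := by
  have hsum := sum_squareDifferenceCount (F := F)
  have hcard := two_mul_card_nonzeroSquares_add_one hF
  rw [Finset.sum_congr rfl fun e he =>
      squareDifferenceCount_eq_one hF (Finset.ne_of_mem_erase he), Finset.sum_const,
    Finset.card_erase_of_mem (Finset.mem_univ _), Finset.card_univ, smul_eq_mul,
    ← squareDifferenceCount_eq_one hF hd] at hsum
  obtain ⟨k, hk⟩ : ∃ k, Fintype.card F = 4 * k + 3 := ⟨Fintype.card F / 4, by omega⟩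
  have hm : (nonzeroSquares F).card = 2 * k + 1 := by omega
  have hk' : (4 * k + 2) * squareDifferenceCount d = (4 * k + 2) * k := by
    rw [hk, hm] at hsum
    have : (2 * k + 1) * (2 * k + 1) - (2 * k + 1) = (4 * k + 2) * k := by
      apply Nat.sub_eq_of_eq_add
      ring
    rw [← this, ← hsum]
    rfl
  have := Nat.eq_of_mul_eq_mul_left (by omega) hk'
  omega

theorem card_filter_pair_subset_translate (hF : Fintype.card F % 4 = 3) {x y : F} (hxy : x ≠ y) :
    (Finset.univ.filter fun a : F => {x, y} ⊆ (nonzeroSquares F).image fun q => q + a).card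
      = (Fintype.card F - 3) / 4 := by
  rw [← squareDifferenceCount_eq hF (sub_ne_zero.mpr hxy.symm)]
  refine Finset.card_bij (fun a _ => x - a) ?_ (fun a _ b _ h => sub_right_injective h) ?_
  · intro a ha
    have h : y + -a = x - a + (y - x) := by ring
    simpa [Finset.insert_subset_iff, ← eq_sub_iff_add_eq, ← sub_eq_add_neg, h] using ha
  · intro b hb
    refine ⟨x - b, ?_, by ring⟩
    have h : y + (b - x) = b + (y - x) := by ring
    simpa [Finset.insert_subset_iff, ← eq_sub_iff_add_eq, h] using hb

theorem card_filter_pair_subset_translate_neg (hF : Fintype.card F % 4 = 3) {x y : F}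
    (hxy : x ≠ y) :
    (Finset.univ.filter fun a : F =>
        {x, y} ⊆ ((nonzeroSquares F).image fun q => -q).image fun q => q + a).card
      = (Fintype.card F - 3) / 4 := by
  rw [← card_filter_pair_subset_translate hF (neg_injective.ne hxy)]
  have h : ∀ z a : F, (∃ q ∈ nonzeroSquares F, -q + a = z) ↔
      ∃ q ∈ nonzeroSquares F, q + -a = -z := fun z a =>
    exists_congr fun q => and_congr_right fun _ => by
      rw [← neg_inj, neg_add, neg_neg]
  refine Finset.card_bij (fun a _ => -a) ?_ (fun a _ b _ => neg_inj.mp) ?_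
  · intro a ha
    simpa only [Finset.mem_filter, Finset.mem_univ, true_and, Finset.insert_subset_iff,
      Finset.singleton_subset_iff, Finset.image_image, Finset.mem_image, Function.comp_apply, h]
      using ha
  · intro b hb
    refine ⟨-b, ?_, neg_neg b⟩
    simpa only [Finset.mem_filter, Finset.mem_univ, true_and, Finset.insert_subset_iff,
      Finset.singleton_subset_iff, Finset.image_image, Finset.mem_image, Function.comp_apply, h,
      neg_neg] using hb

theorem translate_nonzeroSquares_ne_translate_neg (hF : Fintype.card F % 4 = 3)
    (hF7 : 7 ≤ Fintype.card F) (a b : F) :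
    ((nonzeroSquares F).image fun q => q + a)
      ≠ ((nonzeroSquares F).image fun q => -q).image fun q => q + b := by
  intro heq
  have key : ∀ q ∈ nonzeroSquares F, q + (a - b) ∉ nonzeroSquares F := by
    intro q hq hq'
    have hmem := heq ▸ Finset.mem_image_of_mem (fun q => q + a) hq
    simp only [Finset.image_image, Finset.mem_image, Function.comp_apply] at hmem
    obtain ⟨r, hr, h⟩ := hmem
    have hr0 : r ≠ 0 := fun h => zero_notMem_nonzeroSquares (h ▸ hr)
    have hqr : q + (a - b) = -r := by linear_combination -h
    exact (neg_mem_nonzeroSquares_iff hF hr0).mp (hqr ▸ hq') hr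
  by_cases hab : a - b = 0
  · have h1 : (1 : F) ∈ nonzeroSquares F := mem_nonzeroSquares.mpr ⟨1, one_ne_zero, one_mul 1⟩
    exact key 1 h1 (by simpa [hab] using h1)
  · have h0 : squareDifferenceCount (a - b) = 0 :=
      Finset.card_eq_zero.mpr (Finset.filter_eq_empty_iff.mpr fun q hq => key q hq)
    rw [squareDifferenceCount_eq hF hab] at h0
    omega

end NonzeroSquares


theorem stmt11 (p : ℕ) [Fact p.Prime] (hp3 : p % 4 = 3) (hp7 : 7 ≤ p)
    (Q : Finset (ZMod p))
    (hQ : Q = Finset.univ.filter fun a : ZMod p => ∃ x : ZMod p, x ≠ 0 ∧ x * x = a) :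
    -- each block `Q + a` and `-Q + a` has size `(p-1)/2`
    (∀ a : ZMod p, (Q.image fun q => q + a).card = (p - 1) / 2) ∧
    (∀ a : ZMod p, ((Q.image fun q => -q).image fun q => q + a).card = (p - 1) / 2) ∧
    -- every 2-element subset of `F_p` lies in exactly `(p-3)/4` blocks of each family
    (∀ T : Finset (ZMod p), T.card = 2 →
      (Finset.univ.filter fun a : ZMod p => T ⊆ Q.image fun q => q + a).card
        = (p - 3) / 4 ∧
      (Finset.univ.filter fun a : ZMod p =>
          T ⊆ (Q.image fun q => -q).image fun q => q + a).card = (p - 3) / 4) ∧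
    -- the two designs are disjoint: `Q + a ≠ -Q + b` for all `a, b`
    (∀ a b : ZMod p,
      (Q.image fun q => q + a) ≠ ((Q.image fun q => -q).image fun q => q + b)) := by
  replace hQ : Q = nonzeroSquares (ZMod p) := by
    rw [hQ]
    ext a
    simp [mem_nonzeroSquares]
  subst hQ
  have hF : Fintype.card (ZMod p) = p := ZMod.card p
  have hF3 : Fintype.card (ZMod p) % 4 = 3 := by rw [hF, hp3]
  have hcard := two_mul_card_nonzeroSquares_add_one hF3
  refine ⟨fun a => ?_, fun a => ?_, fun T hT => ?_,
    translate_nonzeroSquares_ne_translate_neg hF3 (hF.symm ▸ hp7)⟩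
  · rw [Finset.card_image_of_injective _ (add_left_injective a)]
    omega
  · rw [Finset.card_image_of_injective _ (add_left_injective a),
      Finset.card_image_of_injective _ neg_injective]
    omega
  · obtain ⟨x, y, hxy, rfl⟩ := Finset.card_eq_two.mp hT
    have h₁ := card_filter_pair_subset_translate hF3 hxy
    have h₂ := card_filter_pair_subset_translate_neg hF3 hxy
    rw [hF] at h₁ h₂
    exact ⟨h₁, h₂⟩
end

section
/- (Three-dimensional Borwein solution) Let A₁, A₂, A₃, B₁, B₂, B₃ ∈ ℚ be such that the multisets {±A₁, ±A₂, ±A₃} and {±B₁, ±B₂, ±B₃} are disjoint, and suppose A₁+A₂+A₃ = B₁+B₂+B₃ = 0, A₁²+A₂²+A₃² = B₁²+B₂²+B₃², and A₁⁴+A₂⁴+A₃⁴ = B₁⁴+B₂⁴+B₃⁴. Then [±(A₁,A₂,A₃), ±(A₂,A₃,A₁), ±(A₃,A₁,A₂)] =⁶₅ [±(B₁,B₂,B₃), ±(B₂,B₃,B₁), ±(B₃,B₁,B₂)]: the multisets X = {(A₁,A₂,A₃), (−A₁,−A₂,−A₃), (A₂,A₃,A₁), (−A₂,−A₃,−A₁),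 (A₃,A₁,A₂), (−A₃,−A₁,−A₂)} and the analogously defined Y with the B_i form a PTE₃ solution of degree 5 and size 6. -/
theorem stmt14 (A₁ A₂ A₃ B₁ B₂ B₃ : ℚ)
    (hdisj : Disjoint ({A₁, A₂, A₃, -A₁, -A₂, -A₃} : Multiset ℚ)
             ({B₁, B₂, B₃, -B₁, -B₂, -B₃} : Multiset ℚ))
    (hlinA : A₁ + A₂ + A₃ = 0) (hlinB : B₁ + B₂ + B₃ = 0)
    (h2 : A₁ ^ 2 + A₂ ^ 2 + A₃ ^ 2 = B₁ ^ 2 + B₂ ^ 2 + B₃ ^ 2)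
    (h4 : A₁ ^ 4 + A₂ ^ 4 + A₃ ^ 4 = B₁ ^ 4 + B₂ ^ 4 + B₃ ^ 4) :
    IsPTE 5
      (![![A₁, A₂, A₃], ![-A₁, -A₂, -A₃], ![A₂, A₃, A₁], ![-A₂, -A₃, -A₁],
         ![A₃, A₁, A₂], ![-A₃, -A₁, -A₂]])
      (![![B₁, B₂, B₃], ![-B₁, -B₂, -B₃], ![B₂, B₃, B₁], ![-B₂, -B₃, -B₁],
         ![B₃, B₁, B₂], ![-B₃, -B₁, -B₂]]) := by
  obtain rfl : A₃ = -A₁ - A₂ := by linarith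
  obtain rfl : B₃ = -B₁ - B₂ := by linarith
  have hq : A₁ ^ 2 + A₁ * A₂ + A₂ ^ 2 = B₁ ^ 2 + B₁ * B₂ + B₂ ^ 2 := by linarith
  have hq2 : (A₁ ^ 2 + A₁ * A₂ + A₂ ^ 2) ^ 2 = (B₁ ^ 2 + B₁ * B₂ + B₂ ^ 2) ^ 2 := by rw [hq]
  refine ⟨fun i j hij => ?_, fun k hk hk5 => ?_⟩
  · have h0 := congrFun hij 0
    rw [Multiset.disjoint_left] at hdisj
    refine hdisj ?_ (Eq.mpr (congrArg (· ∈ _) h0) ?_)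
    · fin_cases i <;> simp
    · fin_cases j <;> simp
  · simp only [Fin.sum_univ_three] at hk hk5
    simp only [Fin.sum_univ_six, Fin.prod_univ_three, Matrix.cons_val]
    generalize k 0 = a at *
    generalize k 1 = b at *
    generalize k 2 = c at *
    have ha : a ≤ 5 := by omega
    have hb : b ≤ 5 - a := by omega
    have hc : c ≤ 5 - a - b := by omega
    clear hdisj h2 h4 hlinA hlinB
    interval_cases a <;> interval_cases b <;> interval_cases c <;>
      first | (exfalso; omega) | ring1 | linarith
end

section
/- Let A₁, A₂, A₃, B₁, B₂, B₃ ∈ ℚ be such that the multisets {±A₁, ±A₂, ±A₃} and {±B₁, ±B₂, ±B₃} are disjoint, and suppose A₁+A₂+A₃ = B₁+B₂+B₃ = 0, A₁²+A₂²+A₃² = B₁²+B₂²+B₃², and A₁⁴+A₂⁴+A₃⁴ = B₁⁴+B₂⁴+B₃⁴. Then the multisets X = {±(A₁,A₂), ±(A₂,A₃), ±(A₃,A₁)} and Y = {±(B₁,B₂), ±(B₂,B₃), ±(B₃,B₁)} in ℚ² form a combinatorially proper PTE₂ solution of degree 5 and size 6 (which is ideal, since 6 = 5+1). -/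
/-- The six vectors obtained from `(x, y, z)` by cyclically pairing coordinates, up to sign. -/
def signedCyclicPairs (x y z : ℚ) : Fin 6 → Fin 2 → ℚ :=
  ![![x, y], ![-x, -y], ![y, z], ![-y, -z], ![z, x], ![-z, -x]]

/-- For `x + y + z = 0`, the moments of degree at most `5` depend only on `x² + y² + z²`. -/
theorem signedCyclicPairs_moment_eq {x y z u v w : ℚ} (hx : x + y + z = 0) (hu : u + v + w = 0)
    (h : x ^ 2 + y ^ 2 + z ^ 2 = u ^ 2 + v ^ 2 + w ^ 2) (k : Fin 2 → ℕ) (hk : ∑ j, k j ≤ 5) :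
    ∑ i, ∏ j, signedCyclicPairs x y z i j ^ k j =
      ∑ i, ∏ j, signedCyclicPairs u v w i j ^ k j := by
  obtain rfl : z = -x - y := by linarith
  obtain rfl : w = -u - v := by linarith
  have hQ : x ^ 2 + x * y + y ^ 2 = u ^ 2 + u * v + v ^ 2 := by linear_combination h / 2
  have hQ2 : (x ^ 2 + x * y + y ^ 2) ^ 2 = (u ^ 2 + u * v + v ^ 2) ^ 2 := by rw [hQ]
  simp only [Fin.sum_univ_two] at hk
  simp only [signedCyclicPairs, Fin.sum_univ_six, Fin.prod_univ_two, Matrix.cons_val]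
  generalize k 0 = a at *
  generalize k 1 = b at *
  have ha : a ≤ 5 := by omega
  have hb : b ≤ 5 := by omega
  interval_cases a <;> interval_cases b <;>
    first
    | omega
    | ring1
    | linear_combination 4 * hQ
    | linear_combination -2 * hQ
    | linear_combination 4 * hQ2
    | linear_combination -2 * hQ2
    | linear_combination 2 * hQ2

theorem rank_signedCyclicPairs {x y z : ℚ} (h : x * z ≠ y ^ 2) :
    (Matrix.of (signedCyclicPairs x y z)).rank = 2 := by
  rw [← Matrix.rank_transpose]
  suffices hli : LinearIndependent ℚ (Matrix.of (signedCyclicPairs x y z)).transpose.row by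
    simpa using hli.rank_matrix
  rw [Fintype.linearIndependent_iff]
  intro g hg
  have h₀ : g 0 * x + g 1 * y = 0 := by
    simpa [signedCyclicPairs, Fin.sum_univ_two] using congrFun hg 0
  have h₂ : g 0 * y + g 1 * z = 0 := by
    simpa [signedCyclicPairs, Fin.sum_univ_two] using congrFun hg 2
  have hd : x * z - y ^ 2 ≠ 0 := sub_ne_zero.2 h
  rw [Fin.forall_fin_two]
  constructor
  · refine (mul_eq_zero.1 ?_).resolve_right hd
    linear_combination z * h₀ - y * h₂
  · refine (mul_eq_zero.1 ?_).resolve_right hd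
    linear_combination x * h₂ - y * h₀

theorem eq_zero_of_mul_eq_sq_of_add_eq_zero {x y z : ℚ} (hs : x + y + z = 0)
    (h : x * z = y ^ 2) : x ^ 2 + y ^ 2 + z ^ 2 = 0 := by
  obtain rfl : z = -x - y := by linarith
  linear_combination -2 * h


theorem stmt15 (A₁ A₂ A₃ B₁ B₂ B₃ : ℚ)
    (hdisj : Disjoint ({A₁, A₂, A₃, -A₁, -A₂, -A₃} : Multiset ℚ)
             ({B₁, B₂, B₃, -B₁, -B₂, -B₃} : Multiset ℚ))
    (hlinA : A₁ + A₂ + A₃ = 0) (hlinB : B₁ + B₂ + B₃ = 0)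
    (h2 : A₁ ^ 2 + A₂ ^ 2 + A₃ ^ 2 = B₁ ^ 2 + B₂ ^ 2 + B₃ ^ 2)
    (h4 : A₁ ^ 4 + A₂ ^ 4 + A₃ ^ 4 = B₁ ^ 4 + B₂ ^ 4 + B₃ ^ 4) :
    IsPTE 5
      (![![A₁, A₂], ![-A₁, -A₂], ![A₂, A₃], ![-A₂, -A₃], ![A₃, A₁], ![-A₃, -A₁]])
      (![![B₁, B₂], ![-B₁, -B₂], ![B₂, B₃], ![-B₂, -B₃], ![B₃, B₁], ![-B₃, -B₁]]) ∧
    (Matrix.of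
      (![![A₁, A₂], ![-A₁, -A₂], ![A₂, A₃], ![-A₂, -A₃], ![A₃, A₁], ![-A₃, -A₁]] :
        Fin 6 → Fin 2 → ℚ)).rank = 2 ∧
    (Matrix.of
      (![![B₁, B₂], ![-B₁, -B₂], ![B₂, B₃], ![-B₂, -B₃], ![B₃, B₁], ![-B₃, -B₁]] :
        Fin 6 → Fin 2 → ℚ)).rank = 2 ∧
    (6 : ℕ) = 5 + 1 := by
  have hne : ∀ a ∈ ({A₁, A₂, A₃, -A₁, -A₂, -A₃} : Multiset ℚ),
      ∀ b ∈ ({B₁, B₂, B₃, -B₁, -B₂, -B₃} : Multiset ℚ), a ≠ b := by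
    rintro a ha _ hb rfl
    exact Multiset.disjoint_left.1 hdisj ha hb
  have hA : A₁ ^ 2 + A₂ ^ 2 + A₃ ^ 2 ≠ 0 := by
    intro h
    have hA₁ : A₁ = 0 := by nlinarith [sq_nonneg A₁, sq_nonneg A₂, sq_nonneg A₃]
    have hB₁ : B₁ = 0 := by nlinarith [sq_nonneg B₁, sq_nonneg B₂, sq_nonneg B₃]
    exact hne A₁ (by simp) B₁ (by simp) (hA₁.trans hB₁.symm)
  have hB : B₁ ^ 2 + B₂ ^ 2 + B₃ ^ 2 ≠ 0 := h2 ▸ hA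
  refine ⟨⟨fun i j hij ↦ ?_, fun k _ hk ↦ signedCyclicPairs_moment_eq hlinA hlinB h2 k hk⟩,
    rank_signedCyclicPairs fun h ↦ hA (eq_zero_of_mul_eq_sq_of_add_eq_zero hlinA h),
    rank_signedCyclicPairs fun h ↦ hB (eq_zero_of_mul_eq_sq_of_add_eq_zero hlinB h), rfl⟩
  refine hne _ ?_ _ ?_ (congrFun hij 0)
  · fin_cases i <;> simp
  · fin_cases j <;> simp
end

section
/- (Cartesian product lifting) Let ℓ ≥ 2 and let δ : [ℓ] × [ℓ] → [ℓ] be a Latin square of order ℓ. For each a ∈ [ℓ], let S^(a) be a multiset of n_S vectors in ℚ^{r_S} and T^(a) a multiset of n_T vectors in ℚ^{r_T}, and define the multiset U^(a) ⊆ ℚ^{r_S + r_T} of size ℓ·n_S·n_T as the union over i ∈ [ℓ] of the Cartesian products S^(i) × T^(δ(a,i)) (concatenating each vector of S^(i) with each vector of T^(δ(a,i))). Suppose that [S^(a)] =_{m_S} [S^(b)] and [T^(a)] =_{m_T} [T^(b)] for all distinct a, b ∈ [ℓ]. Then [U^(a)] =_{m_S+m_T+1} [U^(b)] for all distinct a,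 b ∈ [ℓ]; i.e., each such pair is a PTE_{r_S+r_T} solution of degree m_S+m_T+1 and size ℓ·n_S·n_T. -/
/-- Both sides of a PTE solution have the same moments up to the degree, including degree zero. -/
theorem IsPTE.moment_eq {ι κ : Type} [Fintype ι] [Fintype κ] {m : ℕ} {a b : ι → κ → ℚ}
    (h : IsPTE m a b) (k : κ → ℕ) (hk : ∑ j, k j ≤ m) :
    ∑ i, ∏ j, a i j ^ k j = ∑ i, ∏ j, b i j ^ k j := by
  rcases Nat.eq_zero_or_pos (∑ j, k j) with h0 | h0
  · have hz : ∀ j, k j = 0 := by simpa using h0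
    simp [hz]
  · exact h.2 k h0 hk

/-- The moments of a union of Cartesian products split as a sum of products of moments. -/
theorem sum_prod_sumElim_pow {ι α β κ κ' : Type} [Fintype ι] [Fintype α] [Fintype β]
    [Fintype κ] [Fintype κ'] (S : ι → α → κ → ℚ) (T : ι → β → κ' → ℚ) (k : κ ⊕ κ' → ℕ) :
    ∑ p : ι × α × β, ∏ j, (Sum.elim (S p.1 p.2.1) (T p.1 p.2.2) : κ ⊕ κ' → ℚ) j ^ k j =
      ∑ i, (∑ x, ∏ j, S i x j ^ k (Sum.inl j)) * ∑ y, ∏ j, T i y j ^ k (Sum.inr j) := by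
  simp only [Fintype.sum_prod_type, Fintype.prod_sum_type, Sum.elim_inl, Sum.elim_inr,
    Finset.sum_mul_sum]

theorem stmt16 {ℓ nS nT rS rT mS mT : ℕ} (hℓ : 2 ≤ ℓ)
    (δ : Fin ℓ → Fin ℓ → Fin ℓ)
    (hrow : ∀ a, Function.Bijective (δ a))
    (hcol : ∀ i, Function.Bijective fun a => δ a i)
    (S : Fin ℓ → Fin nS → Fin rS → ℚ) (T : Fin ℓ → Fin nT → Fin rT → ℚ)
    (hS : ∀ a b, a ≠ b → IsPTE mS (S a) (S b))
    (hT : ∀ a b, a ≠ b → IsPTE mT (T a) (T b)) :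
    ∀ a b, a ≠ b →
      IsPTE (mS + mT + 1)
        (fun p : Fin ℓ × Fin nS × Fin nT =>
          Sum.elim (S p.1 p.2.1) (T (δ a p.1) p.2.2))
        (fun p : Fin ℓ × Fin nS × Fin nT =>
          Sum.elim (S p.1 p.2.1) (T (δ b p.1) p.2.2)) := by
  intro a b hab
  refine ⟨?_, ?_⟩
  · rintro ⟨i, x, y⟩ ⟨j, x', y'⟩ h
    obtain ⟨h₁, h₂⟩ := Sum.elim_eq_iff.1 h
    by_cases hij : i = j
    · subst hij
      exact (hT _ _ fun hδ => hab ((hcol i).1 hδ)).1 y y' h₂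
    · exact (hS i j hij).1 x x' h₁
  · intro k _ hk
    rw [sum_prod_sumElim_pow S (fun i => T (δ a i)) k,
      sum_prod_sumElim_pow S (fun i => T (δ b i)) k]
    rw [Fintype.sum_sum_type] at hk
    by_cases hkS : ∑ j, k (Sum.inl j) ≤ mS
    · have hconst : ∀ i, ∑ x, ∏ j, S i x j ^ k (Sum.inl j) =
          ∑ x, ∏ j, S a x j ^ k (Sum.inl j) := fun i => by
        by_cases hi : i = a
        · rw [hi]
        · exact (hS i a hi).moment_eq _ hkS
      simp only [hconst, ← Finset.mul_sum]
      congr 1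
      exact ((hrow a).sum_comp fun c => ∑ y, ∏ j, T c y j ^ k (Sum.inr j)).trans
        ((hrow b).sum_comp fun c => ∑ y, ∏ j, T c y j ^ k (Sum.inr j)).symm
    · refine Finset.sum_congr rfl fun i _ => ?_
      congr 1
      exact (hT _ _ fun hδ => hab ((hcol i).1 hδ)).moment_eq _ (by omega)
end

section
/- (Jacroux's partitioning) Let α ≥ 2, and let S^(1),…,S^(α) be multisets of positive integers, each of size n_S and each contained in {1,…,α·n_S}, such that [S^(a)] =_{m_S} [S^(b)] for all distinct a, b ∈ [α]; let T^(1),…,T^(α) be multisets of positive integers, each of size n_T, such that [T^(a)] =_{m_T} [T^(b)] for all distinct a, b ∈ [α]. For a ∈ [α], define the multiset of positive integers Ū^(a) := ⋃_{i,j ∈ [α], i+j ≡ a+1 (mod α)} ⋃_{t ∈ T^(j)} (S^(i) + (t−1)·α·n_S), where S + c denotes the multiset obtained by adding c to every element of S. Then for all distinct a, b ∈ [α], the multisets Ū^(a) and Ū^(b) are disjoint, each of size α·n_S·n_T, and ∑_{u ∈ Ū^(a)} u^k = ∑_{u ∈ Ū^(b)} u^k for every 1 ≤ k ≤ m_S +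 m_T + 1; i.e., [Ū^(a)] =_{m_S+m_T+1} [Ū^(b)]. -/
/-- `(x, y)` is a one-dimensional PTE solution of degree `m`: the two multisets
of natural numbers are disjoint and their `k`-th power sums agree for
`1 ≤ k ≤ m`. -/
def IsPTE1 {ι : Type} [Fintype ι] (m : ℕ) (x y : ι → ℕ) : Prop :=
  (∀ i j, x i ≠ y j) ∧ ∀ k : ℕ, 1 ≤ k → k ≤ m → ∑ i, x i ^ k = ∑ i, y i ^ k

lemma IsPTE1.sum_pow_eq {ι : Type} [Fintype ι] {m : ℕ} {x y : ι → ℕ} (h : IsPTE1 m x y)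
    {k : ℕ} (hk : k ≤ m) : ∑ i, (x i : ℤ) ^ k = ∑ i, (y i : ℤ) ^ k := by
  rcases Nat.eq_zero_or_pos k with rfl | hpos
  · simp
  · exact_mod_cast h.2 k hpos hk

lemma IsPTE1.sum_add_mul_pow_eq {ι : Type} [Fintype ι] {m : ℕ} {x y : ι → ℕ} (h : IsPTE1 m x y)
    (c d : ℤ) {k : ℕ} (hk : k ≤ m) :
    ∑ i, (((x i : ℤ) + c) * d) ^ k = ∑ i, (((y i : ℤ) + c) * d) ^ k := by
  simp only [mul_pow, add_pow, ← Finset.sum_mul]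
  congr 1
  rw [Finset.sum_comm, Finset.sum_comm (s := Finset.univ)]
  refine Finset.sum_congr rfl fun l hl => ?_
  simp only [← Finset.sum_mul]
  rw [h.sum_pow_eq ((Finset.mem_range_succ_iff.mp hl).trans hk)]

/-- The binomial expansion of a power sum over a family of sumsets. -/
lemma sum_add_pow_eq_sum_choose {I J K R : Type*} [Fintype I] [Fintype J] [Fintype K]
    [CommSemiring R] (f : I → J → R) (g : I → K → R) (k : ℕ) :
    ∑ p : I × J × K, (f p.1 p.2.1 + g p.1 p.2.2) ^ k =
      ∑ l ∈ Finset.range (k + 1),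
        (∑ i, (∑ j, f i j ^ l) * ∑ t, g i t ^ (k - l)) * (k.choose l : R) := by
  simp only [add_pow]
  rw [Finset.sum_comm]
  refine Finset.sum_congr rfl fun l _ => ?_
  simp only [Fintype.sum_prod_type, ← Finset.sum_mul, Finset.sum_mul_sum]

/-- A cyclic convolution with a constant factor does not depend on the shift. -/
lemma sum_mul_sub_eq_of_const {G R : Type*} [AddCommGroup G] [Fintype G] [CommSemiring R]
    {P Q : G → R} (h : (∀ a b, P a = P b) ∨ ∀ a b, Q a = Q b) (a b : G) :
    ∑ i, P i * Q (a - i) = ∑ i, P i * Q (b - i) := by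
  rcases h with h | h
  · simp only [h _ 0, ← Finset.mul_sum]
    exact congrArg (P 0 * ·)
      (((Equiv.subLeft a).sum_comp Q).trans ((Equiv.subLeft b).sum_comp Q).symm)
  · exact Finset.sum_congr rfl fun i _ => by rw [h (a - i) (b - i)]

/-- Uniqueness of division with remainder, with remainders in `{1, …, N}`. -/
lemma eq_and_eq_of_add_mul_eq {N s s' t t' : ℕ} (hs : 1 ≤ s) (hsN : s ≤ N) (hs' : 1 ≤ s')
    (hsN' : s' ≤ N) (h : s + t * N = s' + t' * N) : s = s' ∧ t = t' := by
  have ht : t = t' := by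
    rcases lt_trichotomy t t' with hlt | heq | hlt
    · have := Nat.mul_le_mul_right N (Nat.succ_le_of_lt hlt)
      rw [Nat.succ_mul] at this
      omega
    · exact heq
    · have := Nat.mul_le_mul_right N (Nat.succ_le_of_lt hlt)
      rw [Nat.succ_mul] at this
      omega
  subst ht
  exact ⟨by omega, rfl⟩

theorem stmt17 {α nS nT mS mT : ℕ} [NeZero α] (hα : 2 ≤ α)
    (S : ZMod α → Fin nS → ℕ) (T : ZMod α → Fin nT → ℕ)
    (hSpos : ∀ a i, 1 ≤ S a i) (hSle : ∀ a i, S a i ≤ α * nS)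
    (hTpos : ∀ a i, 1 ≤ T a i)
    (hS : ∀ a b, a ≠ b → IsPTE1 mS (S a) (S b))
    (hT : ∀ a b, a ≠ b → IsPTE1 mT (T a) (T b)) :
    ∀ a b : ZMod α, a ≠ b →
      IsPTE1 (mS + mT + 1)
        (fun p : ZMod α × Fin nS × Fin nT =>
          S p.1 p.2.1 + (T (a + 1 - p.1) p.2.2 - 1) * α * nS)
        (fun p : ZMod α × Fin nS × Fin nT =>
          S p.1 p.2.1 + (T (b + 1 - p.1) p.2.2 - 1) * α * nS) := by
  intro a b hab
  refine ⟨?_, ?_⟩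
  · rintro ⟨i, s, t⟩ ⟨j, s', t'⟩ h
    simp only [mul_assoc] at h
    obtain ⟨hs, ht⟩ := eq_and_eq_of_add_mul_eq (hSpos i s) (hSle i s) (hSpos j s') (hSle j s') h
    obtain rfl : i = j := by
      by_contra hij
      exact (hS i j hij).1 s s' hs
    have hne : a + 1 - i ≠ b + 1 - i := fun h => hab (by simpa using h)
    have h1 := hTpos (a + 1 - i) t
    have h2 := hTpos (b + 1 - i) t'
    exact (hT _ _ hne).1 t t' (by omega)
  · intro k _ hk
    have hcast : ∀ c : ZMod α,
        ((∑ p : ZMod α × Fin nS × Fin nT,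
          (S p.1 p.2.1 + (T (c + 1 - p.1) p.2.2 - 1) * α * nS) ^ k : ℕ) : ℤ) =
        ∑ p : ZMod α × Fin nS × Fin nT,
          ((S p.1 p.2.1 : ℤ) + ((T (c + 1 - p.1) p.2.2 : ℤ) + -1) * (α * nS)) ^ k := by
      intro c
      push_cast [Nat.cast_sub (hTpos _ _)]
      exact Finset.sum_congr rfl fun p _ => by ring
    refine Nat.cast_injective (R := ℤ) ?_
    rw [hcast a, hcast b,
      sum_add_pow_eq_sum_choose (fun i j => (S i j : ℤ))
        (fun i t => ((T (a + 1 - i) t : ℤ) + -1) * (α * nS)),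
      sum_add_pow_eq_sum_choose (fun i j => (S i j : ℤ))
        (fun i t => ((T (b + 1 - i) t : ℤ) + -1) * (α * nS))]
    refine Finset.sum_congr rfl fun l _ => ?_
    congr 1
    refine sum_mul_sub_eq_of_const (P := fun i => ∑ j, (S i j : ℤ) ^ l)
      (Q := fun i => ∑ t, (((T i t : ℤ) + -1) * (α * nS)) ^ (k - l)) ?_ (a + 1) (b + 1)
    rcases le_or_gt l mS with hl | hl
    · refine Or.inl fun c d => ?_
      rcases eq_or_ne c d with rfl | hcd
      · rfl
      · exact (hS c d hcd).sum_pow_eq hl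
    · refine Or.inr fun c d => ?_
      rcases eq_or_ne c d with rfl | hcd
      · rfl
      · exact (hT c d hcd).sum_add_mul_pow_eq _ _ (by omega)
end

section
/- (Characterization of ideal PTE₁ solutions) Let n ≥ 2 and let x₁,…,xₙ, y₁,…,yₙ ∈ ℚ be such that the multisets {x₁,…,xₙ} and {y₁,…,yₙ} are disjoint and ∑_{i=1}^n x_i^k = ∑_{i=1}^n y_i^k for every integer 1 ≤ k ≤ n−1. Then the following are equivalent: (i) ∑_{i=1}^n x_i = 0; (ii) ∑_{i=1}^n x_i^{n+1} = ∑_{i=1}^n y_i^{n+1}. -/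
/-- Elementary symmetric functions of degree at most `N` are determined by the power sums of
degree at most `N`. -/
theorem aeval_esymm_eq_of_sum_pow_eq {ι K : Type*} [Fintype ι] [Field K] [CharZero K]
    (x y : ι → K) (N : ℕ)
    (h : ∀ k : ℕ, 1 ≤ k → k ≤ N → ∑ i, x i ^ k = ∑ i, y i ^ k) (k : ℕ) (hk : k ≤ N) :
    MvPolynomial.aeval x (MvPolynomial.esymm ι K k) =
      MvPolynomial.aeval y (MvPolynomial.esymm ι K k) := by
  induction k using Nat.strong_induction_on with
  | _ k ih =>
    rcases Nat.eq_zero_or_pos k with rfl | hpos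
    · simp
    have hx := congrArg (MvPolynomial.aeval x) (MvPolynomial.mul_esymm_eq_sum ι K k)
    have hy := congrArg (MvPolynomial.aeval y) (MvPolynomial.mul_esymm_eq_sum ι K k)
    simp only [map_mul, map_sum, map_pow, map_neg, map_one, map_natCast, MvPolynomial.psum,
      MvPolynomial.aeval_X] at hx hy
    have hk0 : (k : K) ≠ 0 := Nat.cast_ne_zero.mpr hpos.ne'
    refine mul_left_cancel₀ hk0 ?_
    rw [hx, hy]
    congr 1
    refine Finset.sum_congr rfl fun a ha => ?_
    obtain ⟨ha, hlt⟩ := Finset.mem_filter.mp ha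
    have ha := Finset.HasAntidiagonal.mem_antidiagonal.mp ha
    rw [ih a.1 hlt (by omega), h a.2 (by omega) (by omega)]

open Polynomial in
/-- If the power sums of degree less than `n` of two `n`-tuples agree, then the monic polynomials
with these roots differ by a constant. -/
theorem exists_prod_X_sub_C_eq_add_C {K : Type*} [Field K] [CharZero K] {n : ℕ} (x y : Fin n → K)
    (h : ∀ k : ℕ, 1 ≤ k → k ≤ n - 1 → ∑ i, x i ^ k = ∑ i, y i ^ k) :
    ∃ c : K, ∏ i, (X - C (x i)) = ∏ i, (X - C (y i)) + C c := by
  have coeff_eq (z : Fin n → K) (k : ℕ) (hk : k ≤ n) : (∏ i, (X - C (z i))).coeff k =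
      (-1) ^ (n - k) * MvPolynomial.aeval z (MvPolynomial.esymm (Fin n) K (n - k)) := by
    have := Multiset.prod_X_sub_C_coeff (Finset.univ.val.map z) (k := k) (by simpa using hk)
    rw [Multiset.map_map] at this
    rw [MvPolynomial.aeval_esymm_eq_multiset_esymm]
    rw [Multiset.card_map, Finset.card_val, Finset.card_univ, Fintype.card_fin] at this
    exact this
  refine ⟨(∏ i, (X - C (x i))).coeff 0 - (∏ i, (X - C (y i))).coeff 0, ?_⟩
  ext k
  rw [coeff_add, coeff_C]
  split_ifs with hk
  · subst hk; ring
  rw [add_zero]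
  rcases le_or_gt k n with hkn | hkn
  · rw [coeff_eq x k hkn, coeff_eq y k hkn,
      aeval_esymm_eq_of_sum_pow_eq x y (n - 1) h (n - k) (by omega)]
  · rw [coeff_eq_zero_of_natDegree_lt (by simpa using hkn),
      coeff_eq_zero_of_natDegree_lt (by simpa using hkn)]

open Polynomial in
/-- For two `n`-tuples whose power sums of degree less than `n` agree, the difference of the power
sums of degree `n + 1` is a multiple of the sum of the first tuple. -/
theorem sum_pow_succ_sub_sum_pow_succ {K : Type*} [Field K] {n : ℕ} (hn : 2 ≤ n) (x y : Fin n → K)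
    (h : ∀ k : ℕ, 1 ≤ k → k ≤ n - 1 → ∑ i, x i ^ k = ∑ i, y i ^ k) {c : K}
    (hc : ∏ i, (X - C (x i)) = ∏ i, (X - C (y i)) + C c) :
    ∑ i, x i ^ (n + 1) - ∑ i, y i ^ (n + 1) = -((n + 1) * c * ∑ i, x i) := by
  obtain ⟨m, rfl⟩ : ∃ m, n = m + 1 := ⟨n - 1, by omega⟩
  set P : K[X] := ∏ i, (X - C (x i)) with hP
  have hdeg : P.natDegree = m + 1 := by simp [hP]
  have hlead : P.coeff (m + 1) = 1 := by
    have : P.Monic := monic_prod_of_monic _ _ fun i _ => monic_X_sub_C (x i)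
    rw [← hdeg]
    exact this
  have hnext : P.coeff m = -∑ i, x i := by
    simpa using prod_X_sub_C_coeff_card_pred Finset.univ x (by simp)
  have hPx (i) : P.eval (x i) = 0 := by
    rw [hP, eval_prod]
    exact Finset.prod_eq_zero (Finset.mem_univ i) (by simp)
  have hPy (i) : P.eval (y i) = c := by
    rw [hc, eval_add, eval_prod, Finset.prod_eq_zero (Finset.mem_univ i) (by simp)]
    simp
  have hlow (k : ℕ) (hk : k ≤ m) : ∑ i, x i ^ k - ∑ i, y i ^ k = 0 := by
    rcases Nat.eq_zero_or_pos k with rfl | hpos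
    · simp
    · rw [h k hpos (by omega), sub_self]
  have sum_eval (z : Fin (m + 1) → K) (j : ℕ) : ∑ i, z i ^ j * P.eval (z i) =
      ∑ k ∈ Finset.range (m + 1 + 1), P.coeff k * ∑ i, z i ^ (k + j) := by
    simp_rw [eval_eq_sum_range, hdeg, Finset.mul_sum]
    rw [Finset.sum_comm]
    exact Finset.sum_congr rfl fun k _ => Finset.sum_congr rfl fun i _ => by ring
  have sum_eval_sub (j : ℕ) : -(c * ∑ i, y i ^ j) = ∑ k ∈ Finset.range (m + 1 + 1),
      P.coeff k * (∑ i, x i ^ (k + j) - ∑ i, y i ^ (k + j)) := by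
    simp_rw [mul_sub]
    rw [Finset.sum_sub_distrib, ← sum_eval, ← sum_eval]
    simp [hPx, hPy, Finset.mul_sum, mul_comm]
  have h0 := sum_eval_sub 0
  have h1 := sum_eval_sub 1
  rw [Finset.sum_range_succ, Finset.sum_eq_zero (s := Finset.range (m + 1)), hlead] at h0
  · rw [Finset.sum_range_succ, Finset.sum_range_succ,
      Finset.sum_eq_zero (s := Finset.range m), hlead, hnext, ← h 1 le_rfl (by omega)] at h1
    · simp only [pow_zero, pow_one, Finset.sum_const, Finset.card_univ, Fintype.card_fin,
        nsmul_eq_mul, mul_one, add_zero, zero_add, one_mul] at h0 h1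
      rw [← h0] at h1
      linear_combination -h1
    · intro k hk
      rw [hlow _ (by have := Finset.mem_range.mp hk; omega), mul_zero]
  · intro k hk
    rw [hlow _ (by have := Finset.mem_range.mp hk; omega), mul_zero]

theorem stmt18 (n : ℕ) (hn : 2 ≤ n) (x y : Fin n → ℚ)
    (hdisj : ∀ i j, x i ≠ y j)
    (hpte : ∀ k : ℕ, 1 ≤ k → k ≤ n - 1 → ∑ i, x i ^ k = ∑ i, y i ^ k) :
    (∑ i, x i = 0) ↔ ∑ i, x i ^ (n + 1) = ∑ i, y i ^ (n + 1) := by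
  obtain ⟨c, hc⟩ := exists_prod_X_sub_C_eq_add_C x y hpte
  have hc0 : c ≠ 0 := by
    rintro rfl
    let i₀ : Fin n := ⟨0, by omega⟩
    have hx := congrArg (Polynomial.eval (x i₀)) hc
    simp only [map_zero, add_zero, Polynomial.eval_prod, Polynomial.eval_sub, Polynomial.eval_X,
      Polynomial.eval_C] at hx
    rw [Finset.prod_eq_zero (Finset.mem_univ i₀) (sub_self _)] at hx
    exact Finset.prod_ne_zero_iff.mpr (fun j _ => sub_ne_zero.mpr (hdisj i₀ j)) hx.symm
  have hn0 : (n : ℚ) + 1 ≠ 0 := by positivity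
  rw [← sub_eq_zero (a := ∑ i, x i ^ (n + 1)), sum_pow_succ_sub_sum_pow_succ hn x y hpte hc]
  simp [hc0, hn0]
end
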